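/- arXiv:1601.06094 — 3 statements merged into one kernel-verified Lean document; each statement's English description precedes it below -/
import Mathlib

section
/- The function (R,Δ) ↦ G(R,Δ|P) is jointly convex on [0,∞)×[0,∞): for all R₀,R₁,Δ₀,Δ₁ ≥ 0 and all α ∈ [0,1], G(αR₁+(1−α)R₀, αΔ₁+(1−α)Δ₀ | P) ≤ α·G(R₁,Δ₁|P) + (1−α)·G(R₀,Δ₀|P). -/
open Real Filter

noncomputable section

def IsDist {X : Type*} [Fintype X] (P : X → ℝ) : Prop :=
  (∀ x, 0 ≤ P x) ∧ ∑ x, P x = 1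

def IsJoint {X Y : Type*} [Fintype X] [Fintype Y] (q : X → Y → ℝ) : Prop :=
  (∀ x y, 0 ≤ q x y) ∧ ∑ x, ∑ y, q x y = 1

def IsCond {X Y : Type*} [Fintype X] [Fintype Y] (V : X → Y → ℝ) : Prop :=
  (∀ x y, 0 ≤ V x y) ∧ ∀ x, ∑ y, V x y = 1

def margX {X Y : Type*} [Fintype Y] (q : X → Y → ℝ) (x : X) : ℝ := ∑ y, q x y

def margY {X Y : Type*} [Fintype X] (q : X → Y → ℝ) (y : Y) : ℝ := ∑ x, q x y

/-- conditional distribution of `X` given `Y` : `q_{X|Y}(x|y)` -/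
def condXY {X Y : Type*} [Fintype X] (q : X → Y → ℝ) (x : X) (y : Y) : ℝ :=
  q x y / margY q y

/-- conditional distribution of `Y` given `X` : `q_{Y|X}(y|x)` -/
def condYX {X Y : Type*} [Fintype Y] (q : X → Y → ℝ) (x : X) (y : Y) : ℝ :=
  q x y / margX q x

/-- mutual information `I(q_X, q_{Y|X})` of a joint distribution `q` -/
def mutInfo {X Y : Type*} [Fintype X] [Fintype Y] (q : X → Y → ℝ) : ℝ :=
  ∑ x, ∑ y, q x y * Real.log (q x y / (margX q x * margY q y))

/-- divergence `D(q_X ‖ P)` -/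
def klX {X Y : Type*} [Fintype X] [Fintype Y] (q : X → Y → ℝ) (P : X → ℝ) : ℝ :=
  ∑ x, margX q x * Real.log (margX q x / P x)

/-- divergence `D(p ‖ q)` of distributions on `X` -/
def klD {X : Type*} [Fintype X] (p q : X → ℝ) : ℝ :=
  ∑ x, p x * Real.log (p x / q x)

/-- divergence `D(q ‖ p)` of joint distributions -/
def klJoint {X Y : Type*} [Fintype X] [Fintype Y] (q p : X → Y → ℝ) : ℝ :=
  ∑ x, ∑ y, q x y * Real.log (q x y / p x y)

/-- expected distortion `E_q[d(X,Y)]` -/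
def Ed {X Y : Type*} [Fintype X] [Fintype Y] (q d : X → Y → ℝ) : ℝ :=
  ∑ x, ∑ y, q x y * d x y

/-- `G(R,Δ|P)` -/
def G {X Y : Type*} [Fintype X] [Fintype Y] (P : X → ℝ) (d : X → Y → ℝ) (R Δ : ℝ) : ℝ :=
  sInf {v : ℝ | ∃ q : X → Y → ℝ, IsJoint q ∧ Ed q d ≤ Δ ∧
    v = max 0 (mutInfo q - R) + klX q P}

/-- `G^{(λ)}(R,Δ|P)` -/
def Glam {X Y : Type*} [Fintype X] [Fintype Y] (P : X → ℝ) (d : X → Y → ℝ)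
    (lam R Δ : ℝ) : ℝ :=
  sInf {v : ℝ | ∃ q : X → Y → ℝ, IsJoint q ∧ Ed q d ≤ Δ ∧
    v = lam * (mutInfo q - R) + klX q P}

/-- rate distortion function `R(Δ|P)` -/
def RD {X Y : Type*} [Fintype X] [Fintype Y] (P : X → ℝ) (d : X → Y → ℝ) (Δ : ℝ) : ℝ :=
  sInf {v : ℝ | ∃ V : X → Y → ℝ, IsCond V ∧ Ed (fun x y => P x * V x y) d ≤ Δ ∧
    v = mutInfo (fun x y => P x * V x y)}

/-- `Ω^{(μ,λ)}(P)` -/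
def OmegaF {X Y : Type*} [Fintype X] [Fintype Y] (P : X → ℝ) (d : X → Y → ℝ)
    (μ lam : ℝ) : ℝ :=
  sInf {v : ℝ | ∃ q : X → Y → ℝ, IsJoint q ∧
    v = lam * mutInfo q + klX q P + μ * Ed q d}

/-- `G^{(μ,λ)}(R,Δ|P) = Ω^{(μ,λ)}(P) − λR − μΔ` -/
def Gmulam {X Y : Type*} [Fintype X] [Fintype Y] (P : X → ℝ) (d : X → Y → ℝ)
    (μ lam R Δ : ℝ) : ℝ :=
  OmegaF P d μ lam - lam * R - μ * Δ

/-- `ω_q^{(μ,λ)}(x,y)` -/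
def omg {X Y : Type*} [Fintype X] [Fintype Y] (P : X → ℝ) (d : X → Y → ℝ)
    (μ lam : ℝ) (q : X → Y → ℝ) (x : X) (y : Y) : ℝ :=
  Real.log (margX q x ^ (1 - lam) * condXY q x y ^ lam * Real.exp (μ * d x y) / P x)

/-- `F^{(μ,λ)}(p,q) = E_q[ω_p^{(μ,λ)}(X,Y)] + D(q‖p)` -/
def Ffun {X Y : Type*} [Fintype X] [Fintype Y] (P : X → ℝ) (d : X → Y → ℝ)
    (μ lam : ℝ) (p q : X → Y → ℝ) : ℝ :=
  (∑ x, ∑ y, q x y * omg P d μ lam p x y) + klJoint q p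

/-- `Λ_p^{(μ,λ)} = E_p[exp(−ω_p^{(μ,λ)}(X,Y))]` -/
def Lam {X Y : Type*} [Fintype X] [Fintype Y] (P : X → ℝ) (d : X → Y → ℝ)
    (μ lam : ℝ) (p : X → Y → ℝ) : ℝ :=
  ∑ x, ∑ y, p x y * Real.exp (-(omg P d μ lam p x y))

/-- cutoff rate `R_cut^{(λ)}(Δ|P)` -/
def Rcut {X Y : Type*} [Fintype X] [Fintype Y] (P : X → ℝ) (d : X → Y → ℝ)
    (lam Δ : ℝ) : ℝ :=
  sInf {v : ℝ | ∃ q : X → Y → ℝ, IsJoint q ∧ Ed q d ≤ Δ ∧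
    v = mutInfo q + (1 / lam) * klX q P}

/-- Shannon entropy -/
def entropy {X : Type*} [Fintype X] (p : X → ℝ) : ℝ :=
  -∑ x, p x * Real.log (p x)

/-- Tangent-line lower bound for the perspective `a * log (a / b)`. -/
lemma mul_log_div_tangent {a b A B : ℝ} (ha : 0 ≤ a) (hb : 0 ≤ b) (hab : b = 0 → a = 0)
    (hA : 0 < A) (hB : 0 < B) :
    a * Real.log (A / B) + a - b * (A / B) ≤ a * Real.log (a / b) := by
  rcases ha.eq_or_lt with rfl | ha
  · have : 0 ≤ b * (A / B) := by positivity
    simpa using this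
  · have hb' : 0 < b := hb.lt_of_ne fun h => ha.ne' (hab h.symm)
    have h := Real.log_le_sub_one_of_pos (x := A / B / (a / b)) (by positivity)
    rw [Real.log_div (by positivity) (by positivity)] at h
    have h2 := mul_le_mul_of_nonneg_left h ha.le
    have h3 : a * (A / B / (a / b) - 1) = b * (A / B) - a := by field_simp
    rw [h3] at h2
    linarith

/-- Two-term log-sum inequality. -/
lemma add_mul_log_div_add_le {a b a' b' : ℝ} (ha : 0 ≤ a) (hb : 0 ≤ b) (hab : b = 0 → a = 0)
    (ha' : 0 ≤ a') (hb' : 0 ≤ b') (hab' : b' = 0 → a' = 0) :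
    (a + a') * Real.log ((a + a') / (b + b')) ≤
      a * Real.log (a / b) + a' * Real.log (a' / b') := by
  rcases (add_nonneg ha ha').eq_or_lt with h0 | hA
  · have h1 : a = 0 := by linarith
    have h2 : a' = 0 := by linarith
    simp [h1, h2]
  · have hB : 0 < b + b' := by
      refine (add_nonneg hb hb').lt_of_ne fun h => hA.ne' ?_
      rw [hab (by linarith), hab' (by linarith), add_zero]
    have h1 := mul_log_div_tangent ha hb hab hA hB
    have h2 := mul_log_div_tangent ha' hb' hab' hA hB
    have h3 : (b + b') * ((a + a') / (b + b')) = a + a' := by field_simp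
    linarith

lemma mul_mul_log_mul_div_mul (c a b : ℝ) :
    c * a * Real.log (c * a / (c * b)) = c * (a * Real.log (a / b)) := by
  rcases eq_or_ne c 0 with rfl | hc
  · simp
  · rw [mul_div_mul_left _ _ hc, mul_assoc]

/-- Joint convexity of `(a, b) ↦ a * log (a / b)`. -/
lemma mul_log_div_convex {a b a' b' s t : ℝ} (ha : 0 ≤ a) (hb : 0 ≤ b) (hab : b = 0 → a = 0)
    (ha' : 0 ≤ a') (hb' : 0 ≤ b') (hab' : b' = 0 → a' = 0) (hs : 0 ≤ s) (ht : 0 ≤ t) :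
    (s * a + t * a') * Real.log ((s * a + t * a') / (s * b + t * b')) ≤
      s * (a * Real.log (a / b)) + t * (a' * Real.log (a' / b')) := by
  rw [← mul_mul_log_mul_div_mul s, ← mul_mul_log_mul_div_mul t]
  refine add_mul_log_div_add_le (by positivity) (by positivity) ?_ (by positivity)
    (by positivity) ?_
  · intro h
    rcases mul_eq_zero.1 h with h | h
    · simp [h]
    · simp [hab h]
  · intro h
    rcases mul_eq_zero.1 h with h | h
    · simp [h]
    · simp [hab' h]

lemma margX_nonneg {X Y : Type*} [Fintype Y] {q : X → Y → ℝ} (hq : ∀ x y, 0 ≤ q x y) (x : X) :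
    0 ≤ margX q x :=
  Finset.sum_nonneg fun y _ => hq x y

lemma margY_nonneg {X Y : Type*} [Fintype X] {q : X → Y → ℝ} (hq : ∀ x y, 0 ≤ q x y) (y : Y) :
    0 ≤ margY q y :=
  Finset.sum_nonneg fun x _ => hq x y

lemma le_margX {X Y : Type*} [Fintype Y] {q : X → Y → ℝ} (hq : ∀ x y, 0 ≤ q x y)
    (x : X) (y : Y) :
    q x y ≤ margX q x :=
  Finset.single_le_sum (f := fun y => q x y) (fun y _ => hq x y) (Finset.mem_univ y)

lemma le_margY {X Y : Type*} [Fintype X] {q : X → Y → ℝ} (hq : ∀ x y, 0 ≤ q x y)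
    (x : X) (y : Y) :
    q x y ≤ margY q y :=
  Finset.single_le_sum (f := fun x => q x y) (fun x _ => hq x y) (Finset.mem_univ x)

lemma margX_mix {X Y : Type*} [Fintype Y] (q q' : X → Y → ℝ) (s t : ℝ) (x : X) :
    margX (fun x y => s * q x y + t * q' x y) x = s * margX q x + t * margX q' x := by
  simp only [margX, Finset.sum_add_distrib, Finset.mul_sum]

lemma margY_mix {X Y : Type*} [Fintype X] (q q' : X → Y → ℝ) (s t : ℝ) (y : Y) :
    margY (fun x y => s * q x y + t * q' x y) y = s * margY q y + t * margY q' y := by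
  simp only [margY, Finset.sum_add_distrib, Finset.mul_sum]

section Joint

variable {X Y : Type*} [Fintype X] [Fintype Y]

lemma Ed_mix (q q' d : X → Y → ℝ) (s t : ℝ) :
    Ed (fun x y => s * q x y + t * q' x y) d = s * Ed q d + t * Ed q' d := by
  simp only [Ed, add_mul, Finset.sum_add_distrib, Finset.mul_sum, mul_assoc]

lemma IsJoint.mix {q q' : X → Y → ℝ} (hq : IsJoint q) (hq' : IsJoint q') {s t : ℝ}
    (hs : 0 ≤ s) (ht : 0 ≤ t) (hst : s + t = 1) :
    IsJoint fun x y => s * q x y + t * q' x y := by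
  refine ⟨fun x y => add_nonneg (mul_nonneg hs (hq.1 x y)) (mul_nonneg ht (hq'.1 x y)), ?_⟩
  simp only [Finset.sum_add_distrib, ← Finset.mul_sum, hq.2, hq'.2, mul_one, hst]

/-- `I(X;Y) + D(q_X ‖ P) = D(q ‖ P × q_Y)`. -/
lemma mutInfo_add_klX {q : X → Y → ℝ} (hq : ∀ x y, 0 ≤ q x y) {P : X → ℝ} (hP : ∀ x, 0 < P x) :
    mutInfo q + klX q P = klJoint q fun x y => P x * margY q y := by
  have hkl : klX q P = ∑ x, ∑ y, q x y * Real.log (margX q x / P x) := by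
    simp only [klX, ← Finset.sum_mul]
    rfl
  rw [hkl, mutInfo, klJoint, ← Finset.sum_add_distrib]
  refine Finset.sum_congr rfl fun x _ => ?_
  rw [← Finset.sum_add_distrib]
  refine Finset.sum_congr rfl fun y _ => ?_
  rcases (hq x y).eq_or_lt with h | h
  · simp [← h]
  · have hX := h.trans_le (le_margX hq x y)
    have hY := h.trans_le (le_margY hq x y)
    have hPx := hP x
    rw [← mul_add, ← Real.log_mul (by positivity) (by positivity)]
    congr 2
    field_simp

lemma klX_mix_le {q q' : X → Y → ℝ} (hq : ∀ x y, 0 ≤ q x y) (hq' : ∀ x y, 0 ≤ q' x y)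
    {P : X → ℝ} (hP : ∀ x, 0 < P x) {s t : ℝ} (hs : 0 ≤ s) (ht : 0 ≤ t) (hst : s + t = 1) :
    klX (fun x y => s * q x y + t * q' x y) P ≤ s * klX q P + t * klX q' P := by
  simp only [klX, margX_mix, Finset.mul_sum, ← Finset.sum_add_distrib]
  refine Finset.sum_le_sum fun x _ => ?_
  have h := mul_log_div_convex (margX_nonneg hq x) (hP x).le (fun h => absurd h (hP x).ne')
    (margX_nonneg hq' x) (hP x).le (fun h => absurd h (hP x).ne') hs ht
  rwa [← add_mul, hst, one_mul] at h

lemma mutInfo_add_klX_mix_le {q q' : X → Y → ℝ} (hq : ∀ x y, 0 ≤ q x y)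
    (hq' : ∀ x y, 0 ≤ q' x y) {P : X → ℝ} (hP : ∀ x, 0 < P x) {s t : ℝ}
    (hs : 0 ≤ s) (ht : 0 ≤ t) :
    mutInfo (fun x y => s * q x y + t * q' x y) + klX (fun x y => s * q x y + t * q' x y) P ≤
      s * (mutInfo q + klX q P) + t * (mutInfo q' + klX q' P) := by
  have hmix : ∀ x y, 0 ≤ s * q x y + t * q' x y := fun x y =>
    add_nonneg (mul_nonneg hs (hq x y)) (mul_nonneg ht (hq' x y))
  have habs : ∀ {r : X → Y → ℝ}, (∀ x y, 0 ≤ r x y) → ∀ x y,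
      P x * margY r y = 0 → r x y = 0 := fun hr x y h =>
    le_antisymm ((le_margY hr x y).trans
      ((mul_eq_zero.1 h).resolve_left (hP x).ne').le) (hr x y)
  rw [mutInfo_add_klX hmix hP, mutInfo_add_klX hq hP, mutInfo_add_klX hq' hP]
  simp only [klJoint, margY_mix, Finset.mul_sum, ← Finset.sum_add_distrib]
  refine Finset.sum_le_sum fun x _ => Finset.sum_le_sum fun y _ => ?_
  have h := mul_log_div_convex (hq x y) (mul_nonneg (hP x).le (margY_nonneg hq y)) (habs hq x y)
    (hq' x y) (mul_nonneg (hP x).le (margY_nonneg hq' y)) (habs hq' x y) hs ht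
  rwa [mul_left_comm s, mul_left_comm t, ← mul_add] at h

lemma klX_nonneg {q : X → Y → ℝ} (hq : IsJoint q) {P : X → ℝ} (hP : IsDist P)
    (hPpos : ∀ x, 0 < P x) : 0 ≤ klX q P := by
  have h : ∑ x, (margX q x - P x) ≤ klX q P := by
    refine Finset.sum_le_sum fun x _ => ?_
    have := mul_log_div_tangent (margX_nonneg hq.1 x) (hPpos x).le
      (fun h => absurd h (hPpos x).ne') one_pos one_pos
    simpa using this
  have hsum : ∑ x, margX q x = 1 := hq.2
  rwa [Finset.sum_sub_distrib, hsum, hP.2, sub_self] at h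

/-- The objective of `G` is convex in `(q, R)`. -/
lemma objective_mix_le {q q' : X → Y → ℝ} (hq : ∀ x y, 0 ≤ q x y)
    (hq' : ∀ x y, 0 ≤ q' x y) {P : X → ℝ} (hP : ∀ x, 0 < P x) {s t : ℝ}
    (hs : 0 ≤ s) (ht : 0 ≤ t) (hst : s + t = 1) (R R' : ℝ) :
    max 0 (mutInfo (fun x y => s * q x y + t * q' x y) - (s * R + t * R')) +
        klX (fun x y => s * q x y + t * q' x y) P ≤
      s * (max 0 (mutInfo q - R) + klX q P) + t * (max 0 (mutInfo q' - R') + klX q' P) := by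
  have h1 := klX_mix_le hq hq' hP hs ht hst
  have h2 := mutInfo_add_klX_mix_le hq hq' hP hs ht
  have a1 := mul_le_mul_of_nonneg_left (le_max_left 0 (mutInfo q - R)) hs
  have a2 := mul_le_mul_of_nonneg_left (le_max_right 0 (mutInfo q - R)) hs
  have b1 := mul_le_mul_of_nonneg_left (le_max_left 0 (mutInfo q' - R')) ht
  have b2 := mul_le_mul_of_nonneg_left (le_max_right 0 (mutInfo q' - R')) ht
  rw [← le_sub_iff_add_le]
  refine max_le ?_ ?_ <;> linarith

lemma bddBelow_objective {P : X → ℝ} (hP : IsDist P) (hPpos : ∀ x, 0 < P x)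
    (d : X → Y → ℝ) (R Δ : ℝ) :
    BddBelow {v : ℝ | ∃ q : X → Y → ℝ, IsJoint q ∧ Ed q d ≤ Δ ∧
      v = max 0 (mutInfo q - R) + klX q P} := by
  refine ⟨0, ?_⟩
  rintro v ⟨q, hq, -, rfl⟩
  exact add_nonneg (le_max_left _ _) (klX_nonneg hq hP hPpos)

lemma nonempty_objective {P : X → ℝ} (hP : IsDist P) {d : X → Y → ℝ}
    (hd0 : ∀ x, ∃ y, d x y = 0) (R : ℝ) {Δ : ℝ} (hΔ : 0 ≤ Δ) :
    {v : ℝ | ∃ q : X → Y → ℝ, IsJoint q ∧ Ed q d ≤ Δ ∧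
      v = max 0 (mutInfo q - R) + klX q P}.Nonempty := by
  classical
  choose f hf using hd0
  refine ⟨_, fun x y => if y = f x then P x else 0, ⟨fun x y => ?_, ?_⟩, ?_, rfl⟩
  · dsimp only
    split_ifs
    exacts [hP.1 x, le_rfl]
  · simp [hP.2]
  · simpa [Ed, hf] using hΔ

end Joint

/-- `(R,Δ) ↦ G(R,Δ|P)` is jointly convex on `[0,∞)×[0,∞)`. -/
theorem stmt2 {X Y : Type*} [Fintype X] [Fintype Y]
    (P : X → ℝ) (hP : IsDist P) (hPpos : ∀ x, 0 < P x)
    (d : X → Y → ℝ) (hd : ∀ x y, 0 ≤ d x y) (hd0 : ∀ x, ∃ y, d x y = 0) :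
    ∀ R₀ R₁ Δ₀ Δ₁ α : ℝ, 0 ≤ R₀ → 0 ≤ R₁ → 0 ≤ Δ₀ → 0 ≤ Δ₁ →
      0 ≤ α → α ≤ 1 →
      G P d (α * R₁ + (1 - α) * R₀) (α * Δ₁ + (1 - α) * Δ₀) ≤
        α * G P d R₁ Δ₁ + (1 - α) * G P d R₀ Δ₀ := by
  intro R₀ R₁ Δ₀ Δ₁ α _ _ hΔ₀ hΔ₁ hα hα1
  have hβ : 0 ≤ 1 - α := sub_nonneg.2 hα1
  refine le_of_forall_pos_le_add fun ε hε => ?_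
  obtain ⟨_, ⟨q₁, hq₁, he₁, rfl⟩, hv₁⟩ := exists_lt_of_csInf_lt
    (nonempty_objective hP hd0 R₁ hΔ₁) (show G P d R₁ Δ₁ < G P d R₁ Δ₁ + ε by linarith)
  obtain ⟨_, ⟨q₀, hq₀, he₀, rfl⟩, hv₀⟩ := exists_lt_of_csInf_lt
    (nonempty_objective hP hd0 R₀ hΔ₀) (show G P d R₀ Δ₀ < G P d R₀ Δ₀ + ε by linarith)
  have hst : α + (1 - α) = 1 := add_sub_cancel _ _
  have hE : Ed (fun x y => α * q₁ x y + (1 - α) * q₀ x y) d ≤ α * Δ₁ + (1 - α) * Δ₀ := by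
    rw [Ed_mix]
    gcongr
  have hle := csInf_le (bddBelow_objective hP hPpos d (α * R₁ + (1 - α) * R₀) _)
    ⟨_, hq₁.mix hq₀ hα hβ hst, hE, rfl⟩
  calc G P d (α * R₁ + (1 - α) * R₀) (α * Δ₁ + (1 - α) * Δ₀)
      ≤ _ := hle
    _ ≤ _ := objective_mix_le hq₁.1 hq₀.1 hPpos hα hβ hst R₁ R₀
    _ ≤ α * (G P d R₁ Δ₁ + ε) + (1 - α) * (G P d R₀ Δ₀ + ε) := by gcongr
    _ = α * G P d R₁ Δ₁ + (1 - α) * G P d R₀ Δ₀ + ε := by ring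
end
end

section
/- For every R ≥ 0 and Δ ≥ 0, G(R,Δ|P) = max over λ ∈ [0,1] of G^{(λ)}(R,Δ|P); in particular G(R,Δ|P) ≥ G^{(λ)}(R,Δ|P) for every λ ∈ [0,1], and there exists λ ∈ [0,1] with G(R,Δ|P) = G^{(λ)}(R,Δ|P). -/
open Real Filter

noncomputable section

/-- Minimax for two convex functions: the infimum of their pointwise maximum is a lower bound for
some convex combination of the two. -/
theorem exists_weight_sInf_max_le {E : Type*} [AddCommGroup E] [Module ℝ E] {K : Set E}
    (hK : K.Nonempty) {f g : E → ℝ} (hf : ConvexOn ℝ K f) (hg : ConvexOn ℝ K g)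
    (hb : BddBelow ((fun q => max (f q) (g q)) '' K)) :
    ∃ w : ℝ, 0 ≤ w ∧ w ≤ 1 ∧
      ∀ q ∈ K, sInf ((fun q => max (f q) (g q)) '' K) ≤ (1 - w) * f q + w * g q := by
  set c := sInf ((fun q => max (f q) (g q)) '' K) with hc
  let B : Set (ℝ × ℝ) := {p | ∃ q ∈ K, f q ≤ p.1 ∧ g q ≤ p.2}
  have hB : Convex ℝ B := by
    rintro ⟨a₁, b₁⟩ ⟨q₁, hq₁, h₁, h₁'⟩ ⟨a₂, b₂⟩ ⟨q₂, hq₂, h₂, h₂'⟩ s t hs ht hst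
    refine ⟨s • q₁ + t • q₂, hf.1 hq₁ hq₂ hs ht hst, ?_, ?_⟩
    · refine (hf.2 hq₁ hq₂ hs ht hst).trans ?_
      simp only [smul_eq_mul, Prod.smul_mk, Prod.mk_add_mk] at *
      gcongr
    · refine (hg.2 hq₁ hq₂ hs ht hst).trans ?_
      simp only [smul_eq_mul, Prod.smul_mk, Prod.mk_add_mk] at *
      gcongr
  have hdisj : Disjoint (Set.Iio c ×ˢ Set.Iio c) B := by
    rw [Set.disjoint_left]
    rintro ⟨a, b⟩ ⟨ha, hb'⟩ ⟨q, hq, h₁, h₂⟩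
    have hle : c ≤ max (f q) (g q) := csInf_le hb ⟨q, hq, rfl⟩
    simp only [Set.mem_Iio] at ha hb' h₁ h₂
    exact absurd hle (not_le.2 (max_lt (h₁.trans_lt ha) (h₂.trans_lt hb')))
  obtain ⟨φ, u, hA, hBu⟩ := geometric_hahn_banach_open
    ((convex_Iio c).prod (convex_Iio c)) (isOpen_Iio.prod isOpen_Iio) hB hdisj
  set α := φ (1, 0) with hα
  set β := φ (0, 1) with hβ
  have hφ : ∀ a b : ℝ, φ (a, b) = a * α + b * β := by
    intro a b
    have : ((a, b) : ℝ × ℝ) = a • (1, 0) + b • (0, 1) := by simp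
    rw [this, map_add, map_smul, map_smul, smul_eq_mul, smul_eq_mul]
  have hBu' : ∀ q ∈ K, ∀ m n : ℝ, 0 ≤ m → 0 ≤ n → u ≤ (f q + m) * α + (g q + n) * β := by
    intro q hq m n hm hn
    rw [← hφ]
    exact hBu _ ⟨q, hq, by simpa, by simpa⟩
  obtain ⟨q₀, hq₀⟩ := hK
  have hA' : ∀ ε > 0, (c - ε) * (α + β) < u := by
    intro ε hε
    have := hA (c - ε, c - ε) ⟨by simpa using hε, by simpa using hε⟩
    rw [hφ] at this
    linarith
  have nonneg_of_bdd : ∀ v k : ℝ, (∀ m, 0 ≤ m → k ≤ m * v) → 0 ≤ v := by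
    intro v k h
    by_contra! hv
    have hv' : 0 < -v := neg_pos.2 hv
    have := h ((|k| + 1) / (-v)) (by positivity)
    have h2 : (|k| + 1) / (-v) * v = -(|k| + 1) := by
      rw [div_neg, neg_mul, div_mul_cancel₀ _ hv.ne]
    rw [h2] at this
    linarith [neg_abs_le k]
  have hα0 : 0 ≤ α := nonneg_of_bdd α (u - f q₀ * α - g q₀ * β) fun m hm => by
    linarith [hBu' q₀ hq₀ m 0 hm le_rfl]
  have hβ0 : 0 ≤ β := nonneg_of_bdd β (u - f q₀ * α - g q₀ * β) fun m hm => by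
    linarith [hBu' q₀ hq₀ 0 m le_rfl hm]
  have hpos : 0 < α + β := by
    refine lt_of_le_of_ne (by positivity) fun h => ?_
    have h1 := hA' 1 one_pos
    have h2 := hBu' q₀ hq₀ 0 0 le_rfl le_rfl
    have ha : α = 0 := by linarith
    have hb : β = 0 := by linarith
    simp only [ha, hb] at h1 h2
    linarith
  have hcu : c * (α + β) ≤ u := by
    refine le_of_forall_pos_le_add fun ε hε => ?_
    have := hA' (ε / (α + β)) (by positivity)
    rw [sub_mul, div_mul_cancel₀ _ hpos.ne'] at this
    linarith
  refine ⟨β / (α + β), by positivity, (div_le_one hpos).2 (by linarith), fun q hq => ?_⟩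
  have h := hBu' q hq 0 0 le_rfl le_rfl
  have : (1 - β / (α + β)) * f q + β / (α + β) * g q = (f q * α + g q * β) / (α + β) := by
    field_simp
    ring
  rw [this, le_div_iff₀ hpos]
  linarith

/-- Tangent-plane bound for the perspective of `t ↦ t log t`. -/
theorem sub_mul_le_mul_log_div_sub {t s r : ℝ} (ht : 0 ≤ t) (hs : 0 ≤ s) (hst : s = 0 → t = 0)
    (hr : 0 < r) : t * Real.log r + t - s * r ≤ t * Real.log (t / s) := by
  rcases ht.eq_or_lt with rfl | ht
  · simp only [zero_mul, zero_add, zero_sub, Left.neg_nonpos_iff]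
    positivity
  have hs' : 0 < s := hs.lt_of_ne' fun h => ht.ne' (hst h)
  have h := Real.log_le_sub_one_of_pos (show 0 < r / (t / s) by positivity)
  rw [Real.log_div hr.ne' (by positivity)] at h
  have h2 := mul_le_mul_of_nonneg_left h ht.le
  have h3 : t * (r / (t / s) - 1) = s * r - t := by field_simp
  linarith

/-- Joint convexity of `(t, s) ↦ t log (t / s)`. -/
theorem mul_log_div_convex_s7 {t₁ t₂ s₁ s₂ a b : ℝ} (ht₁ : 0 ≤ t₁) (ht₂ : 0 ≤ t₂) (hs₁ : 0 ≤ s₁)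
    (hs₂ : 0 ≤ s₂) (h₁ : s₁ = 0 → t₁ = 0) (h₂ : s₂ = 0 → t₂ = 0) (ha : 0 ≤ a) (hb : 0 ≤ b) :
    (a * t₁ + b * t₂) * Real.log ((a * t₁ + b * t₂) / (a * s₁ + b * s₂)) ≤
      a * (t₁ * Real.log (t₁ / s₁)) + b * (t₂ * Real.log (t₂ / s₂)) := by
  have p₁ : 0 ≤ a * t₁ := by positivity
  have p₂ : 0 ≤ b * t₂ := by positivity
  rcases (add_nonneg p₁ p₂).eq_or_lt with hT | hT
  · have e₁ : a * t₁ = 0 := by linarith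
    have e₂ : b * t₂ = 0 := by linarith
    simp [← mul_assoc, e₁, e₂]
  have hS : 0 < a * s₁ + b * s₂ := by
    refine lt_of_le_of_ne (by positivity) fun h => hT.ne' ?_
    have r₁ : 0 ≤ a * s₁ := by positivity
    have r₂ : 0 ≤ b * s₂ := by positivity
    have e₁ : a * s₁ = 0 := by linarith
    have e₂ : b * s₂ = 0 := by linarith
    have e₁' : a * t₁ = 0 := by
      rcases mul_eq_zero.1 e₁ with h | h <;> simp [h, h₁]
    have e₂' : b * t₂ = 0 := by
      rcases mul_eq_zero.1 e₂ with h | h <;> simp [h, h₂]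
    linarith
  set T := a * t₁ + b * t₂
  set S := a * s₁ + b * s₂ with hSdef
  have k₁ := mul_le_mul_of_nonneg_left
    (sub_mul_le_mul_log_div_sub ht₁ hs₁ h₁ (div_pos hT hS)) ha
  have k₂ := mul_le_mul_of_nonneg_left
    (sub_mul_le_mul_log_div_sub ht₂ hs₂ h₂ (div_pos hT hS)) hb
  have e : S * (T / S) = T := mul_div_cancel₀ _ hS.ne'
  calc T * Real.log (T / S) = T * Real.log (T / S) + T - S * (T / S) := by rw [e]; ring
    _ = a * (t₁ * Real.log (T / S) + t₁ - s₁ * (T / S)) +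
        b * (t₂ * Real.log (T / S) + t₂ - s₂ * (T / S)) := by
      simp only [T, hSdef]; ring
    _ ≤ _ := add_le_add k₁ k₂

section Joint

variable {X Y : Type*}

theorem margX_add_smul [Fintype Y] (q₁ q₂ : X → Y → ℝ) (a b : ℝ) (x : X) :
    margX (a • q₁ + b • q₂) x = a * margX q₁ x + b * margX q₂ x := by
  simp [margX, Finset.sum_add_distrib, Finset.mul_sum]

theorem margY_add_smul [Fintype X] (q₁ q₂ : X → Y → ℝ) (a b : ℝ) (y : Y) :
    margY (a • q₁ + b • q₂) y = a * margY q₁ y + b * margY q₂ y := by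
  simp [margY, Finset.sum_add_distrib, Finset.mul_sum]

variable [Fintype X] [Fintype Y]

theorem Ed_add_smul (q₁ q₂ d : X → Y → ℝ) (a b : ℝ) :
    Ed (a • q₁ + b • q₂) d = a * Ed q₁ d + b * Ed q₂ d := by
  simp [Ed, Finset.sum_add_distrib, Finset.mul_sum, add_mul, mul_assoc]

namespace IsJoint

variable {q : X → Y → ℝ}

theorem margX_nonneg (hq : IsJoint q) (x : X) : 0 ≤ margX q x :=
  Finset.sum_nonneg fun y _ => hq.1 x y

theorem margY_nonneg (hq : IsJoint q) (y : Y) : 0 ≤ margY q y :=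
  Finset.sum_nonneg fun x _ => hq.1 x y

theorem le_margX (hq : IsJoint q) (x : X) (y : Y) : q x y ≤ margX q x :=
  Finset.single_le_sum (f := fun y => q x y) (fun y _ => hq.1 x y) (Finset.mem_univ y)

theorem le_margY (hq : IsJoint q) (x : X) (y : Y) : q x y ≤ margY q y :=
  Finset.single_le_sum (f := fun x => q x y) (fun x _ => hq.1 x y) (Finset.mem_univ x)

theorem sum_margX (hq : IsJoint q) : ∑ x, margX q x = 1 := hq.2

theorem sum_margY (hq : IsJoint q) : ∑ y, margY q y = 1 := by
  simp only [margY]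
  rw [Finset.sum_comm]
  exact hq.2

theorem eq_zero_of_mul_margY_eq_zero (hq : IsJoint q) {p : ℝ} (hp : 0 < p) {x : X} {y : Y}
    (h : p * margY q y = 0) : q x y = 0 := by
  have hy : margY q y = 0 := (mul_eq_zero.1 h).resolve_left hp.ne'
  exact le_antisymm (hy ▸ hq.le_margY x y) (hq.1 x y)

theorem mutInfo_nonneg (hq : IsJoint q) : 0 ≤ mutInfo q := by
  have h : ∀ x y, q x y - margX q x * margY q y ≤
      q x y * Real.log (q x y / (margX q x * margY q y)) := by
    intro x y
    have := sub_mul_le_mul_log_div_sub (r := 1) (hq.1 x y)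
      (mul_nonneg (hq.margX_nonneg x) (hq.margY_nonneg y)) (fun h => ?_) one_pos
    · simpa using this
    · rcases mul_eq_zero.1 h with h | h
      · exact le_antisymm (h ▸ hq.le_margX x y) (hq.1 x y)
      · exact le_antisymm (h ▸ hq.le_margY x y) (hq.1 x y)
  calc (0 : ℝ) = ∑ x, ∑ y, (q x y - margX q x * margY q y) := by
        simp only [Finset.sum_sub_distrib, ← Finset.mul_sum, hq.sum_margY, hq.2, mul_one,
          hq.sum_margX, sub_self]
    _ ≤ mutInfo q := Finset.sum_le_sum fun x _ => Finset.sum_le_sum fun y _ => h x y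

theorem klX_nonneg (hq : IsJoint q) {P : X → ℝ} (hP : IsDist P) (hPpos : ∀ x, 0 < P x) :
    0 ≤ klX q P := by
  calc (0 : ℝ) = ∑ x, (margX q x - P x) := by
        rw [Finset.sum_sub_distrib, hq.sum_margX, hP.2, sub_self]
    _ ≤ klX q P := Finset.sum_le_sum fun x _ => by
        simpa using sub_mul_le_mul_log_div_sub (r := 1) (hq.margX_nonneg x) (hPpos x).le
          (fun h => absurd h (hPpos x).ne') one_pos

theorem mutInfo_add_klX (hq : IsJoint q) {P : X → ℝ} (hPpos : ∀ x, 0 < P x) :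
    mutInfo q + klX q P = ∑ x, ∑ y, q x y * Real.log (q x y / (P x * margY q y)) := by
  have hk : klX q P = ∑ x, ∑ y, q x y * Real.log (margX q x / P x) := by
    simp only [klX, margX, Finset.sum_mul]
  rw [hk, mutInfo, ← Finset.sum_add_distrib]
  refine Finset.sum_congr rfl fun x _ => ?_
  rw [← Finset.sum_add_distrib]
  refine Finset.sum_congr rfl fun y _ => ?_
  rcases (hq.1 x y).eq_or_lt with h | h
  · simp [← h]
  have hx : 0 < margX q x := h.trans_le (hq.le_margX x y)
  have hy : 0 < margY q y := h.trans_le (hq.le_margY x y)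
  have := hPpos x
  rw [← mul_add, ← Real.log_mul (by positivity) (by positivity)]
  congr 2
  field_simp

end IsJoint

theorem convex_setOf_isJoint_and_Ed_le (d : X → Y → ℝ) (Δ : ℝ) :
    Convex ℝ {q : X → Y → ℝ | IsJoint q ∧ Ed q d ≤ Δ} := by
  rintro q₁ ⟨h₁, e₁⟩ q₂ ⟨h₂, e₂⟩ a b ha hb hab
  refine ⟨⟨fun x y => ?_, ?_⟩, ?_⟩
  · have := h₁.1 x y
    have := h₂.1 x y
    simp only [Pi.add_apply, Pi.smul_apply, smul_eq_mul]
    positivity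
  · change ∑ x, margX (a • q₁ + b • q₂) x = 1
    simp only [margX_add_smul, Finset.sum_add_distrib, ← Finset.mul_sum, h₁.sum_margX,
      h₂.sum_margX, mul_one, hab]
  · rw [Ed_add_smul]
    calc a * Ed q₁ d + b * Ed q₂ d ≤ a * Δ + b * Δ := by gcongr
      _ = Δ := by rw [← add_mul, hab, one_mul]

theorem convexOn_klX {P : X → ℝ} (hPpos : ∀ x, 0 < P x) {K : Set (X → Y → ℝ)}
    (hK : Convex ℝ K) (hKj : ∀ q ∈ K, IsJoint q) : ConvexOn ℝ K fun q => klX q P := by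
  refine ⟨hK, fun q₁ hq₁ q₂ hq₂ a b ha hb hab => ?_⟩
  simp only [klX, smul_eq_mul, Finset.mul_sum, ← Finset.sum_add_distrib, margX_add_smul]
  refine Finset.sum_le_sum fun x _ => ?_
  have h := mul_log_div_convex_s7 ((hKj q₁ hq₁).margX_nonneg x) ((hKj q₂ hq₂).margX_nonneg x)
    (hPpos x).le (hPpos x).le (fun h => absurd h (hPpos x).ne')
    (fun h => absurd h (hPpos x).ne') ha hb
  rwa [← add_mul a b (P x), hab, one_mul] at h

theorem convexOn_mutInfo_add_klX {P : X → ℝ} (hPpos : ∀ x, 0 < P x) {K : Set (X → Y → ℝ)}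
    (hK : Convex ℝ K) (hKj : ∀ q ∈ K, IsJoint q) :
    ConvexOn ℝ K fun q => mutInfo q + klX q P := by
  refine ⟨hK, fun q₁ hq₁ q₂ hq₂ a b ha hb hab => ?_⟩
  have j₁ := hKj q₁ hq₁
  have j₂ := hKj q₂ hq₂
  have j := hKj _ (hK hq₁ hq₂ ha hb hab)
  simp only [j₁.mutInfo_add_klX hPpos, j₂.mutInfo_add_klX hPpos, j.mutInfo_add_klX hPpos,
    smul_eq_mul, Finset.mul_sum, ← Finset.sum_add_distrib, margY_add_smul]
  refine Finset.sum_le_sum fun x _ => Finset.sum_le_sum fun y _ => ?_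
  have h := mul_log_div_convex_s7 (j₁.1 x y) (j₂.1 x y)
    (mul_nonneg (hPpos x).le (j₁.margY_nonneg y)) (mul_nonneg (hPpos x).le (j₂.margY_nonneg y))
    (j₁.eq_zero_of_mul_margY_eq_zero (hPpos x)) (j₂.eq_zero_of_mul_margY_eq_zero (hPpos x)) ha hb
  simp only [Pi.add_apply, Pi.smul_apply, smul_eq_mul]
  rwa [show a * (P x * margY q₁ y) + b * (P x * margY q₂ y) =
    P x * (a * margY q₁ y + b * margY q₂ y) by ring] at h

end Joint

/-- `G(R,Δ|P) = max_{λ∈[0,1]} G^{(λ)}(R,Δ|P)`: in particular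
`G ≥ G^{(λ)}` for every `λ ∈ [0,1]`, and some `λ ∈ [0,1]` attains equality. -/
theorem stmt7 {X Y : Type*} [Fintype X] [Fintype Y]
    (P : X → ℝ) (hP : IsDist P) (hPpos : ∀ x, 0 < P x)
    (d : X → Y → ℝ) (hd : ∀ x y, 0 ≤ d x y) (hd0 : ∀ x, ∃ y, d x y = 0) :
    ∀ R Δ : ℝ, 0 ≤ R → 0 ≤ Δ →
      (∀ lam : ℝ, 0 ≤ lam → lam ≤ 1 → Glam P d lam R Δ ≤ G P d R Δ) ∧
      (∃ lam : ℝ, 0 ≤ lam ∧ lam ≤ 1 ∧ G P d R Δ = Glam P d lam R Δ) := by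
  intro R Δ _ _
  let K : Set (X → Y → ℝ) := {q | IsJoint q ∧ Ed q d ≤ Δ}
  have hG : G P d R Δ = sInf ((fun q => max 0 (mutInfo q - R) + klX q P) '' K) := by
    simp only [G, K, Set.image, Set.mem_ofPred_eq, and_assoc, eq_comm]
  have hL : ∀ lam, Glam P d lam R Δ =
      sInf ((fun q => lam * (mutInfo q - R) + klX q P) '' K) := fun lam => by
    simp only [Glam, K, Set.image, Set.mem_ofPred_eq, and_assoc, eq_comm]
  rcases K.eq_empty_or_nonempty with hK | hK
  · exact ⟨fun lam _ _ => by simp [hG, hL, hK], 0, le_rfl, zero_le_one, by simp [hG, hL, hK]⟩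
  have hbL : ∀ lam : ℝ, 0 ≤ lam →
      BddBelow ((fun q => lam * (mutInfo q - R) + klX q P) '' K) := by
    rintro lam h0
    refine ⟨-(lam * R), ?_⟩
    rintro _ ⟨q, hq, rfl⟩
    have h1 := mul_nonneg h0 hq.1.mutInfo_nonneg
    have h2 := hq.1.klX_nonneg hP hPpos
    dsimp only
    linarith
  have hbG : BddBelow ((fun q => max 0 (mutInfo q - R) + klX q P) '' K) := by
    refine ⟨0, ?_⟩
    rintro _ ⟨q, hq, rfl⟩
    exact add_nonneg (le_max_left _ _) (hq.1.klX_nonneg hP hPpos)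
  have hle : ∀ lam : ℝ, 0 ≤ lam → lam ≤ 1 → Glam P d lam R Δ ≤ G P d R Δ := by
    intro lam h0 h1
    rw [hG, hL]
    refine le_csInf (hK.image _) ?_
    rintro _ ⟨q, hq, rfl⟩
    refine (csInf_le (hbL lam h0) ⟨q, hq, rfl⟩).trans ?_
    have h2 : lam * (mutInfo q - R) ≤ lam * max 0 (mutInfo q - R) :=
      mul_le_mul_of_nonneg_left (le_max_right _ _) h0
    have h3 : lam * max 0 (mutInfo q - R) ≤ max 0 (mutInfo q - R) :=
      mul_le_of_le_one_left (le_max_left _ _) h1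
    dsimp only
    linarith
  refine ⟨hle, ?_⟩
  have hmax : (fun q : X → Y → ℝ => max 0 (mutInfo q - R) + klX q P) =
      fun q => max (klX q P) (mutInfo q + klX q P + -R) := by
    funext q
    rw [← max_add_add_right]
    congr 1 <;> ring
  have hKc : Convex ℝ K := convex_setOf_isJoint_and_Ed_le d Δ
  rw [hmax] at hbG
  obtain ⟨w, hw0, hw1, hw⟩ := exists_weight_sInf_max_le hK
    (convexOn_klX hPpos hKc fun q hq => hq.1)
    ((convexOn_mutInfo_add_klX hPpos hKc fun q hq => hq.1).add_const (-R)) hbG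
  refine ⟨w, hw0, hw1, le_antisymm ?_ (hle w hw0 hw1)⟩
  rw [hG, hL, hmax]
  refine le_csInf (hK.image _) ?_
  rintro _ ⟨q, hq, rfl⟩
  refine (hw q hq).trans (le_of_eq ?_)
  simp only [Pi.add_apply]
  ring
end
end

section
/- For every joint distribution q on 𝒳×𝒴 and every joint distribution p on 𝒳×𝒴 with all components positive, F^{(μ,λ)}(p,q) ≥ F^{(μ,λ)}(q,q) = E_q[ω_q^{(μ,λ)}(X,Y)] = λ I(q_X,q_{Y|X}) + D(q_X||P) + μ E_q[d(X,Y)], with equality when p = q; consequently, the minimum of F^{(μ,λ)}(p,q) over all pairs (p,q) equals the minimum over q of E_q[ω_q^{(μ,λ)}(X,Y)], which equals Ω^{(μ,λ)}(P). -/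
open Real Filter

noncomputable section

theorem margX_pos {X Y : Type*} [Fintype Y] {q : X → Y → ℝ} (hq : ∀ x y, 0 ≤ q x y)
    {x : X} {y : Y} (h : 0 < q x y) : 0 < margX q x :=
  h.trans_le (Finset.single_le_sum (f := fun y => q x y) (fun y _ => hq x y) (Finset.mem_univ y))

theorem margY_pos {X Y : Type*} [Fintype X] {q : X → Y → ℝ} (hq : ∀ x y, 0 ≤ q x y)
    {x : X} {y : Y} (h : 0 < q x y) : 0 < margY q y :=
  h.trans_le (Finset.single_le_sum (f := fun x => q x y) (fun x _ => hq x y) (Finset.mem_univ x))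

theorem omg_eq_of_pos {X Y : Type*} [Fintype X] [Fintype Y] {P : X → ℝ} (d : X → Y → ℝ)
    (μ lam : ℝ) {q : X → Y → ℝ} (hq : ∀ x y, 0 ≤ q x y) {x : X} {y : Y} (hP : 0 < P x)
    (h : 0 < q x y) :
    omg P d μ lam q x y = (1 - lam) * Real.log (margX q x) +
      lam * (Real.log (q x y) - Real.log (margY q y)) + μ * d x y - Real.log (P x) := by
  have hX := margX_pos hq h
  have hY := margY_pos hq h
  have hc : 0 < condXY q x y := div_pos h hY
  have h1 : 0 < margX q x ^ (1 - lam) := Real.rpow_pos_of_pos hX _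
  have h2 : 0 < condXY q x y ^ lam := Real.rpow_pos_of_pos hc _
  rw [omg, Real.log_div (by positivity) hP.ne', Real.log_mul (by positivity) (by positivity),
    Real.log_mul h1.ne' h2.ne', Real.log_rpow hX, Real.log_rpow hc, Real.log_exp, condXY,
    Real.log_div h.ne' hY.ne']

theorem klJoint_self {X Y : Type*} [Fintype X] [Fintype Y] (q : X → Y → ℝ) :
    klJoint q q = 0 := by
  refine Finset.sum_eq_zero fun x _ => Finset.sum_eq_zero fun y _ => ?_
  by_cases h : q x y = 0 <;> simp [h]

theorem Ffun_self {X Y : Type*} [Fintype X] [Fintype Y] (P : X → ℝ) (d : X → Y → ℝ)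
    (μ lam : ℝ) (q : X → Y → ℝ) :
    Ffun P d μ lam q q = ∑ x, ∑ y, q x y * omg P d μ lam q x y := by
  rw [Ffun, klJoint_self, add_zero]

theorem sum_mul_omg_self {X Y : Type*} [Fintype X] [Fintype Y] {P : X → ℝ}
    (hP : ∀ x, 0 < P x) (d : X → Y → ℝ) (μ lam : ℝ) {q : X → Y → ℝ}
    (hq : ∀ x y, 0 ≤ q x y) :
    ∑ x, ∑ y, q x y * omg P d μ lam q x y = lam * mutInfo q + klX q P + μ * Ed q d := by
  have hkl : klX q P = ∑ x, ∑ y, q x y * Real.log (margX q x / P x) := by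
    refine Finset.sum_congr rfl fun x _ => ?_
    rw [← Finset.sum_mul, margX]
  rw [hkl, mutInfo, Ed]
  simp only [Finset.mul_sum, ← Finset.sum_add_distrib]
  refine Finset.sum_congr rfl fun x _ => Finset.sum_congr rfl fun y _ => ?_
  rcases (hq x y).eq_or_lt with h | h
  · simp [← h]
  · have hX := margX_pos hq h
    have hY := margY_pos hq h
    rw [omg_eq_of_pos d μ lam hq (hP x) h, Real.log_div h.ne' (mul_pos hX hY).ne',
      Real.log_mul hX.ne' hY.ne', Real.log_div hX.ne' (hP x).ne']
    ring

/-- The log-sum type bound `E_q[ω_q] ≤ F(p,q)`, before summation over `(x,y)`. -/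
theorem mul_omg_add_le {X Y : Type*} [Fintype X] [Fintype Y] {P : X → ℝ}
    (hP : ∀ x, 0 < P x) (d : X → Y → ℝ) (μ : ℝ) {lam : ℝ} (h0 : 0 ≤ lam) (h1 : lam ≤ 1)
    {p q : X → Y → ℝ} (hp : ∀ x y, 0 < p x y) (hq : ∀ x y, 0 ≤ q x y) (x : X) (y : Y) :
    q x y * omg P d μ lam q x y + ((1 - lam) * (q x y - p x y / margX p x * margX q x) +
        lam * (q x y - q x y / margY q y * margY p y)) ≤
      q x y * omg P d μ lam p x y + q x y * Real.log (q x y / p x y) := by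
  have hp0 : ∀ x y, 0 ≤ p x y := fun x y => (hp x y).le
  have hpX := margX_pos hp0 (hp x y)
  have hpY := margY_pos hp0 (hp x y)
  rcases (hq x y).eq_or_lt with h | h
  · have hqX : 0 ≤ margX q x := Finset.sum_nonneg fun y _ => hq x y
    have : 0 ≤ (1 - lam) * (p x y / margX p x * margX q x) :=
      mul_nonneg (sub_nonneg.2 h1) (mul_nonneg (div_nonneg (hp0 x y) hpX.le) hqX)
    simp only [← h]
    simp only [zero_mul, zero_div, sub_zero, mul_zero, zero_add, add_zero]
    linarith
  · have hX := margX_pos hq h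
    have hY := margY_pos hq h
    have hpxy := hp x y
    have e1 := Real.log_le_sub_one_of_pos
      (show 0 < p x y * margX q x / (margX p x * q x y) by positivity)
    have e2 := Real.log_le_sub_one_of_pos (show 0 < margY p y / margY q y by positivity)
    rw [Real.log_div (by positivity) (by positivity), Real.log_mul hpxy.ne' hX.ne',
      Real.log_mul hpX.ne' h.ne'] at e1
    rw [Real.log_div hpY.ne' hY.ne'] at e2
    rw [omg_eq_of_pos d μ lam hq (hP x) h, omg_eq_of_pos d μ lam hp0 (hP x) hpxy,
      Real.log_div h.ne' hpxy.ne']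
    have f1 := mul_le_mul_of_nonneg_left e1 (mul_nonneg (sub_nonneg.2 h1) h.le)
    have f2 := mul_le_mul_of_nonneg_left e2 (mul_nonneg h0 h.le)
    have g1 : (1 - lam) * q x y * (p x y * margX q x / (margX p x * q x y) - 1) =
        -((1 - lam) * (q x y - p x y / margX p x * margX q x)) := by
      field_simp
      ring
    have g2 : lam * q x y * (margY p y / margY q y - 1) =
        -(lam * (q x y - q x y / margY q y * margY p y)) := by
      field_simp
      ring
    rw [g1] at f1
    rw [g2] at f2
    linarith

theorem Ffun_self_le {X Y : Type*} [Fintype X] [Fintype Y] {P : X → ℝ}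
    (hP : ∀ x, 0 < P x) (d : X → Y → ℝ) (μ : ℝ) {lam : ℝ} (h0 : 0 ≤ lam) (h1 : lam ≤ 1)
    {p q : X → Y → ℝ} (hpJ : IsJoint p) (hp : ∀ x y, 0 < p x y) (hq : IsJoint q) :
    Ffun P d μ lam q q ≤ Ffun P d μ lam p q := by
  have hsum := Finset.sum_le_sum fun x (_ : x ∈ Finset.univ) =>
    Finset.sum_le_sum fun y (_ : y ∈ Finset.univ) => mul_omg_add_le hP d μ h0 h1 hp hq.1 x y
  simp only [Finset.sum_add_distrib, ← Finset.mul_sum, Finset.sum_sub_distrib, hq.2] at hsum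
  have hX : ∑ x, ∑ y, p x y / margX p x * margX q x ≤ 1 := by
    rw [← hq.2]
    refine Finset.sum_le_sum fun x _ => ?_
    rw [← Finset.sum_mul, ← Finset.sum_div]
    exact mul_le_of_le_one_left (Finset.sum_nonneg fun y _ => hq.1 x y) (div_self_le_one _)
  have hY : ∑ x, ∑ y, q x y / margY q y * margY p y ≤ 1 := by
    rw [← hpJ.2, Finset.sum_comm, Finset.sum_comm (f := p)]
    refine Finset.sum_le_sum fun y _ => ?_
    rw [← Finset.sum_mul, ← Finset.sum_div]
    exact mul_le_of_le_one_left (Finset.sum_nonneg fun x _ => hpJ.1 x y) (div_self_le_one _)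
  have k1 := mul_nonneg (sub_nonneg.2 h1) (sub_nonneg.2 hX)
  have k2 := mul_nonneg h0 (sub_nonneg.2 hY)
  rw [Ffun_self, Ffun, klJoint]
  linarith

theorem tendsto_Ffun {X Y : Type*} [Fintype X] [Fintype Y] {P : X → ℝ}
    (hP : ∀ x, 0 < P x) (d : X → Y → ℝ) (μ lam : ℝ) {q : X → Y → ℝ}
    (hq : ∀ x y, 0 ≤ q x y) {ι : Type*} {l : Filter ι} {p : ι → X → Y → ℝ}
    (hp : ∀ x y, Tendsto (fun i => p i x y) l (nhds (q x y))) :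
    Tendsto (fun i => Ffun P d μ lam (p i) q) l (nhds (Ffun P d μ lam q q)) := by
  have hpX : ∀ x, Tendsto (fun i => margX (p i) x) l (nhds (margX q x)) := fun x =>
    tendsto_finsetSum _ fun y _ => hp x y
  have hpY : ∀ y, Tendsto (fun i => margY (p i) y) l (nhds (margY q y)) := fun y =>
    tendsto_finsetSum _ fun x _ => hp x y
  refine Tendsto.add (tendsto_finsetSum _ fun x _ => tendsto_finsetSum _ fun y _ => ?_)
    (tendsto_finsetSum _ fun x _ => tendsto_finsetSum _ fun y _ => ?_)
  all_goals
    rcases (hq x y).eq_or_lt with h | h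
    · simpa [← h] using tendsto_const_nhds
    refine Tendsto.const_mul _ (Tendsto.log ?_ ?_)
  · have hX := margX_pos hq h
    have hY := margY_pos hq h
    have hc : condXY q x y ≠ 0 := (div_pos h hY).ne'
    exact ((((hpX x).rpow_const (Or.inl hX.ne')).mul
      (((hp x y).div (hpY y) hY.ne').rpow_const (Or.inl hc))).mul_const _).div_const _
  · have hX := margX_pos hq h
    have hY := margY_pos hq h
    have hPx := hP x
    have h1 : 0 < margX q x ^ (1 - lam) := Real.rpow_pos_of_pos hX _
    have h2 : 0 < condXY q x y ^ lam := Real.rpow_pos_of_pos (div_pos h hY) _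
    positivity
  · exact Tendsto.div tendsto_const_nhds (hp x y) h.ne'
  · exact (div_pos h h).ne'

/-- Positive joint distributions are dense among all joint distributions. -/
theorem IsJoint.exists_pos_tendsto {X Y : Type*} [Fintype X] [Fintype Y] {q : X → Y → ℝ}
    (hq : IsJoint q) : ∃ p : ℕ → X → Y → ℝ, (∀ n, IsJoint (p n)) ∧ (∀ n x y, 0 < p n x y) ∧
      ∀ x y, Tendsto (fun n => p n x y) atTop (nhds (q x y)) := by
  have hne : Nonempty X ∧ Nonempty Y := by
    constructor <;> by_contra hcon <;> rw [not_nonempty_iff] at hcon <;> simpa using hq.2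
  obtain ⟨_, _⟩ := hne
  have hcX : (0 : ℝ) < Fintype.card X := by exact_mod_cast Fintype.card_pos
  have hcY : (0 : ℝ) < Fintype.card Y := by exact_mod_cast Fintype.card_pos
  let u : ℝ := (Fintype.card X * Fintype.card Y : ℝ)⁻¹
  have hu : 0 < u := by positivity
  have hpos : ∀ (n : ℕ) x y, 0 < q x y + 1 / ((n : ℝ) + 1) * (u - q x y) := by
    intro n x y
    have ha : 0 < 1 / ((n : ℝ) + 1) := by positivity
    rcases (hq.1 x y).eq_or_lt with h | h
    · rw [← h]
      simpa using mul_pos ha hu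
    · have hb : 1 / ((n : ℝ) + 1) ≤ 1 := by
        rw [div_le_one (by positivity)]
        linarith [(Nat.cast_nonneg n : (0 : ℝ) ≤ n)]
      nlinarith [mul_pos ha hu, mul_nonneg (sub_nonneg.2 hb) h.le]
  refine ⟨fun n x y => q x y + 1 / ((n : ℝ) + 1) * (u - q x y),
    fun n => ⟨fun x y => (hpos n x y).le, ?_⟩, hpos, fun x y => ?_⟩
  · have hsu : (Fintype.card X : ℝ) * (Fintype.card Y * u) = 1 := by
      simp only [u]
      field_simp
    simp only [Finset.sum_add_distrib, ← Finset.mul_sum, Finset.sum_sub_distrib, hq.2]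
    simp [hsu]
  · simpa using (tendsto_one_div_add_atTop_nhds_zero_nat (𝕜 := ℝ)).mul_const (u - q x y)
      |>.const_add (q x y)

theorem Real.sInf_eq_of_lowerBounds_eq {A B : Set ℝ} (h : lowerBounds A = lowerBounds B) :
    sInf A = sInf B := by
  have hemp : ∀ S : Set ℝ, lowerBounds S = Set.univ ↔ S = ∅ := fun S =>
    ⟨fun hS => Set.eq_empty_of_forall_notMem fun b hb => by
      have : b + 1 ∈ lowerBounds S := hS ▸ Set.mem_univ _
      linarith [this hb], fun hS => by simp [hS]⟩
  by_cases hA : A = ∅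
  · rw [hA, (hemp B).1 (h ▸ (hemp A).2 hA)]
  have hB : B ≠ ∅ := fun hB => hA ((hemp A).1 (h ▸ (hemp B).2 hB))
  by_cases hbd : BddBelow A
  · have hbd' : BddBelow B := by rwa [BddBelow, ← h]
    have g1 := isGLB_csInf (Set.nonempty_iff_ne_empty.2 hA) hbd
    have g2 := isGLB_csInf (Set.nonempty_iff_ne_empty.2 hB) hbd'
    rw [IsGLB, h] at g1
    exact g1.unique g2
  · have hbd' : ¬BddBelow B := by rwa [BddBelow, ← h]
    rw [Real.sInf_of_not_bddBelow hbd, Real.sInf_of_not_bddBelow hbd']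

/-- Lemma 3: `F^{(μ,λ)}(p,q) ≥ F^{(μ,λ)}(q,q) = E_q[ω_q^{(μ,λ)}]
= λI(q_X,q_{Y|X}) + D(q_X‖P) + μ E_q[d(X,Y)]`, with equality when `p = q`;
consequently `min_{p,q} F^{(μ,λ)}(p,q) = min_q E_q[ω_q^{(μ,λ)}] = Ω^{(μ,λ)}(P)`. -/
theorem stmt9 {X Y : Type*} [Fintype X] [Fintype Y]
    (P : X → ℝ) (hP : IsDist P) (hPpos : ∀ x, 0 < P x)
    (d : X → Y → ℝ) (hd : ∀ x y, 0 ≤ d x y)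
    (μ lam : ℝ) (hμ : 0 ≤ μ) (hlam0 : 0 ≤ lam) (hlam1 : lam ≤ 1) :
    (∀ p q : X → Y → ℝ, IsJoint p → (∀ x y, 0 < p x y) → IsJoint q →
      Ffun P d μ lam q q ≤ Ffun P d μ lam p q) ∧
    (∀ q : X → Y → ℝ, IsJoint q →
      Ffun P d μ lam q q = (∑ x, ∑ y, q x y * omg P d μ lam q x y) ∧
      (∑ x, ∑ y, q x y * omg P d μ lam q x y) =
        lam * mutInfo q + klX q P + μ * Ed q d) ∧
    (sInf {v : ℝ | ∃ p q : X → Y → ℝ, IsJoint p ∧ (∀ x y, 0 < p x y) ∧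
        IsJoint q ∧ v = Ffun P d μ lam p q} =
      sInf {v : ℝ | ∃ q : X → Y → ℝ, IsJoint q ∧
        v = ∑ x, ∑ y, q x y * omg P d μ lam q x y}) ∧
    (sInf {v : ℝ | ∃ q : X → Y → ℝ, IsJoint q ∧
        v = ∑ x, ∑ y, q x y * omg P d μ lam q x y} = OmegaF P d μ lam) := by
  have hid : ∀ q : X → Y → ℝ, IsJoint q → (∑ x, ∑ y, q x y * omg P d μ lam q x y) =
      lam * mutInfo q + klX q P + μ * Ed q d := fun q hq =>
    sum_mul_omg_self hPpos d μ lam hq.1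
  refine ⟨fun p q hpJ hp hq => Ffun_self_le hPpos d μ hlam0 hlam1 hpJ hp hq,
    fun q hq => ⟨Ffun_self P d μ lam q, hid q hq⟩, ?_, ?_⟩
  · refine Real.sInf_eq_of_lowerBounds_eq (Set.Subset.antisymm ?_ ?_)
    · rintro m hm _ ⟨q, hq, rfl⟩
      obtain ⟨p, hpJ, hp, hlim⟩ := hq.exists_pos_tendsto
      rw [← Ffun_self]
      exact ge_of_tendsto' (tendsto_Ffun hPpos d μ lam hq.1 hlim) fun n =>
        hm ⟨p n, q, hpJ n, hp n, hq, rfl⟩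
    · rintro m hm _ ⟨p, q, hpJ, hp, hq, rfl⟩
      refine le_trans ?_ (Ffun_self_le hPpos d μ hlam0 hlam1 hpJ hp hq)
      rw [Ffun_self]
      exact hm ⟨q, hq, rfl⟩
  · rw [OmegaF]
    congr 1
    ext v
    exact exists_congr fun q => and_congr_right fun hq => by rw [hid q hq]
end
end
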